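/- Let T be a triangulated category with arbitrary small coproducts, P a compact generator of T, and suppose Λ is N-sparse and gl dim Λ < N. Fix i ∈ ℤ/N and let X, Y be objects of T with π_*X ∈ B[i−1] and π_*Y ∈ B[i]. For any morphism f: X → Y, complete f to a distinguished triangle X → Y → C → ΣX. Then applying π_* yields a short exact sequence of graded Λ-modules 0 → π_*Y → π_*C → (π_*X)[1] → 0, and the map Hom_T(X, Y) → Ext¹_Λ((π_*X)[1], π_*Y), sending f to the extension class of this short exact sequence, is well-defined (independent of the chosen triangle) and bijective. -/

import Mathlib

/-!
Shared setup: a triangulated category `C` with (co)products, a compact generator `P`,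
the graded endomorphism ring `Λ = End_T(P)_* = Hom_T(Σ^* P, P)` and its category of
graded right modules, realized concretely.
-/

set_option linter.unusedSectionVars false

open CategoryTheory CategoryTheory.Limits CategoryTheory.Pretriangulated DirectSum

universe v u

namespace Franke

variable {C : Type u} [Category.{v} C] [Preadditive C] [HasZeroObject C]
  [HasShift C ℤ] [∀ n : ℤ, (shiftFunctor C n).Additive] [Pretriangulated C]

/-- The degree `k` component of the graded endomorphism ring
`Λ = End_T(P)_* = Hom_T(Σ^* P, P)`: its degree `k` part is `Hom(P⟦k⟧, P)`. -/
abbrev lam (P : C) (k : ℤ) : Type v := (P⟦k⟧ ⟶ P)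

/-- The right action of a degree `k` element `a : Σᵏ P ⟶ P` of `Λ` on a degree `n`
element `m : Σⁿ P ⟶ X` of the graded hom `π_* X = Hom_T(Σ^* P, X)`; the result is the
degree `n + k` element `Σ^{n+k} P ≅ (Σᵏ P)⟦n⟧ → Σⁿ P → X`. -/
def gsmulHom (P : C) {X : C} {n k l : ℤ} (h : n + k = l)
    (m : P⟦n⟧ ⟶ X) (a : lam P k) : P⟦l⟧ ⟶ X :=
  (shiftFunctorAdd' C k n l (by omega)).hom.app P ≫ a⟦n⟧' ≫ m

/-- The multiplication of the graded endomorphism ring `Λ = End_T(P)_*`. -/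
def gmul (P : C) {j k l : ℤ} (h : j + k = l) (a : lam P j) (b : lam P k) : lam P l :=
  gsmulHom P h a b

/-- The unit `1 ∈ Λ₀ = Hom(Σ⁰P, P)` of the graded endomorphism ring. -/
def gone (P : C) : lam P 0 := (shiftFunctorZero C ℤ).hom.app P

/-- A ℤ-graded right module over the graded endomorphism ring `Λ = End_T(P)_*`.
The action is indexed by proofs `n + k = l` in order to avoid transport along
equalities of degrees. -/
structure GradedModule (P : C) where
  M : ℤ → Type v
  [acg : ∀ n, AddCommGroup (M n)]
  smul : ∀ {n k l : ℤ}, n + k = l → M n → lam P k → M l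
  smul_addₓ : ∀ {n k l : ℤ} (h : n + k = l) (m : M n) (a b : lam P k),
    smul h m (a + b) = smul h m a + smul h m b
  add_smulₓ : ∀ {n k l : ℤ} (h : n + k = l) (m m' : M n) (a : lam P k),
    smul h (m + m') a = smul h m a + smul h m' a
  smul_oneₓ : ∀ {n : ℤ} (m : M n), smul (add_zero n) m (gone P) = m
  smul_mulₓ : ∀ {n j k nj jk njk : ℤ} (h₁ : n + j = nj) (h₂ : j + k = jk)
    (h₃ : nj + k = njk) (h₄ : n + jk = njk) (m : M n) (a : lam P j) (b : lam P k),
    smul h₃ (smul h₁ m a) b = smul h₄ m (gmul P h₂ a b)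

attribute [instance] GradedModule.acg

/-- The action of a fixed `a : Λₖ` as an additive map `Mₙ →+ M_{n+k}`. -/
def GradedModule.smulAddHom {P : C} (M : GradedModule P) {n k l : ℤ} (h : n + k = l)
    (a : lam P k) : M.M n →+ M.M l :=
  AddMonoidHom.mk' (fun m => M.smul h m a) (fun m m' => M.add_smulₓ h m m' a)

theorem GradedModule.zero_smulₓ {P : C} (M : GradedModule P) {n k l : ℤ} (h : n + k = l)
    (a : lam P k) : M.smul h (0 : M.M n) a = 0 :=
  map_zero (M.smulAddHom h a)

/-- `π_* X = Hom_T(Σ^* P, X)` as a graded right `Λ`-module. -/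
@[reducible] def piMod (P X : C) : GradedModule P where
  M n := P⟦n⟧ ⟶ X
  smul h m a := gsmulHom P h m a
  smul_addₓ h m a b := by
    simp [gsmulHom, Functor.map_add, Preadditive.comp_add, Preadditive.add_comp]
  add_smulₓ h m m' a := by
    simp [gsmulHom, Preadditive.comp_add]
  smul_oneₓ m := by
    simp only [gsmulHom, gone]
    rw [shiftFunctorAdd'_zero_add_hom_app, ← Functor.map_comp_assoc, Iso.inv_hom_id_app]
    simp
  smul_mulₓ {n j k nj jk njk} h₁ h₂ h₃ h₄ m a b := by
    simp only [gsmulHom, gmul, Functor.map_comp, Category.assoc]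
    have nat := ((shiftFunctorAdd' C j n nj (by omega)).hom).naturality b
    dsimp at nat
    rw [reassoc_of% nat]
    rw [← shiftFunctorAdd'_assoc_hom_app_assoc k j n jk nj njk (by omega) (by omega)
      (by omega) P]


/-- A morphism of graded right `Λ`-modules: a degree-preserving `Λ`-linear additive map. -/
structure GHom {P : C} (M N : GradedModule P) where
  app : ∀ n : ℤ, M.M n →+ N.M n
  app_smul : ∀ {n k l : ℤ} (h : n + k = l) (m : M.M n) (a : lam P k),
    app l (M.smul h m a) = N.smul h (app n m) a

@[ext] theorem GHom.ext {P : C} {M N : GradedModule P} {f g : GHom M N}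
    (h : ∀ (n : ℤ) (x : M.M n), f.app n x = g.app n x) : f = g := by
  obtain ⟨fa, _⟩ := f; obtain ⟨ga, _⟩ := g
  congr 1
  funext n
  exact AddMonoidHom.ext (h n)

/-- The identity morphism of graded modules. -/
def GHom.id {P : C} (M : GradedModule P) : GHom M M :=
  ⟨fun _ => AddMonoidHom.id _, fun _ _ _ => rfl⟩

/-- Composition of morphisms of graded modules. -/
def GHom.comp {P : C} {M N K : GradedModule P} (g : GHom N K) (f : GHom M N) : GHom M K :=
  ⟨fun n => (g.app n).comp (f.app n), fun h m a => by
    simp only [AddMonoidHom.comp_apply, f.app_smul, g.app_smul]⟩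

instance {P : C} {M N : GradedModule P} : Zero (GHom M N) :=
  ⟨{ app := fun _ => 0
     app_smul := fun h m a => by
       show (0 : N.M _) = N.smul h (0 : N.M _) a
       exact (N.zero_smulₓ h a).symm }⟩

@[simp] theorem GHom.zero_app {P : C} {M N : GradedModule P} (n : ℤ) (x : M.M n) :
    (0 : GHom M N).app n x = 0 := rfl

/-- An isomorphism of graded right `Λ`-modules. -/
structure GIso {P : C} (M N : GradedModule P) where
  hom : GHom M N
  inv : GHom N M
  hom_inv_id : inv.comp hom = GHom.id M
  inv_hom_id : hom.comp inv = GHom.id N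

/-- The shift `M[k]` of a graded module, with `M[k]ₙ = M_{n-k}`. -/
@[reducible] def gshift {P : C} (k : ℤ) (M : GradedModule P) : GradedModule P where
  M n := M.M (n - k)
  smul h m a := M.smul (by omega) m a
  smul_addₓ h m a b := M.smul_addₓ _ m a b
  add_smulₓ h m m' a := M.add_smulₓ _ m m' a
  smul_oneₓ m := M.smul_oneₓ m
  smul_mulₓ h₁ h₂ h₃ h₄ m a b := M.smul_mulₓ _ h₂ _ _ m a b

/-- Surjectivity (in each degree) of a morphism of graded modules. -/
def GHom.Surj {P : C} {M N : GradedModule P} (f : GHom M N) : Prop :=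
  ∀ n : ℤ, Function.Surjective (f.app n)

/-- A pair of composable morphisms of graded modules `0 → Z → E → B → 0`
forming a short exact sequence. -/
structure IsShortExact {P : C} {Z E B : GradedModule P} (ι : GHom Z E) (ρ : GHom E B) : Prop where
  mono : ∀ n : ℤ, Function.Injective (ι.app n)
  epi : ∀ n : ℤ, Function.Surjective (ρ.app n)
  exact : ∀ (n : ℤ) (x : E.M n), ρ.app n x = 0 ↔ x ∈ Set.range (ι.app n)

/-- Exactness of `M → N → K` at `N` (including that the composite vanishes). -/
def ExactPair {P : C} {M N K : GradedModule P} (f : GHom M N) (g : GHom N K) : Prop :=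
  ∀ (n : ℤ) (x : N.M n), g.app n x = 0 ↔ x ∈ Set.range (f.app n)

/-- A graded module is projective if every degreewise surjection onto it splits against
any map from it: the usual lifting property. -/
def IsProjective {P : C} (Q : GradedModule P) : Prop :=
  ∀ (A B : GradedModule P) (e : GHom A B), e.Surj →
    ∀ f : GHom Q B, ∃ g : GHom Q A, e.comp g = f

/-- `projDimLE d M` says that the graded module `M` admits a projective resolution of
length at most `d`, i.e. has projective dimension `≤ d`. -/
def projDimLE {P : C} : ℕ → GradedModule P → Prop
  | 0, M => IsProjective M
  | d + 1, M => ∃ (F K : GradedModule P) (ε : GHom F M) (ι : GHom K F),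
      IsProjective F ∧ IsShortExact ι ε ∧ projDimLE d K

/-- `Λ = End_T(P)_*` is `N`-sparse: concentrated in degrees divisible by `N`. -/
def Sparse (P : C) (N : ℕ) : Prop :=
  ∀ k : ℤ, ¬ ((N : ℤ) ∣ k) → ∀ a : lam P k, a = 0

/-- A graded module belongs to `B[i]`: it is concentrated in degrees congruent
to `i` modulo `N`. -/
def InDegrees {P : C} (N : ℕ) (i : ZMod N) (M : GradedModule P) : Prop :=
  ∀ n : ℤ, (n : ZMod N) ≠ i → ∀ x : M.M n, x = 0

/-- The canonical comparison map `⊕ᵢ Hom(P, Xᵢ) → Hom(P, ∐ᵢ Xᵢ)`. -/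
noncomputable def compactComparison [HasCoproducts.{v} C] (P : C) {ι : Type v} (X : ι → C) :
    (⨁ i, (P ⟶ X i)) →+ (P ⟶ ∐ X) := by
  classical
  exact DirectSum.toAddMonoid fun i =>
    AddMonoidHom.mk' (fun f => f ≫ Sigma.ι X i) (fun f g => Preadditive.add_comp _ _ _ _ _ _)

/-- `P` is a compact object: `Hom(P, −)` commutes with small coproducts. -/
def IsCompactObj [HasCoproducts.{v} C] (P : C) : Prop :=
  ∀ (ι : Type v) (X : ι → C), Function.Bijective (compactComparison P X)

/-- `P` is a generator: an object all of whose graded homs from `P` vanish is zero. -/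
def IsGenerator (P : C) : Prop :=
  ∀ X : C, (∀ (n : ℤ) (f : P⟦n⟧ ⟶ X), f = 0) → IsZero X

/-- The morphism of graded modules `π_* f : π_* X → π_* Y` induced by `f : X ⟶ Y`. -/
def piGHom (P : C) {X Y : C} (f : X ⟶ Y) : GHom (piMod P X) (piMod P Y) where
  app n := AddMonoidHom.mk' (fun u => u ≫ f) fun u v => Preadditive.add_comp _ _ _ _ _ _
  app_smul h m a := by
    show (gsmulHom P h m a) ≫ f = gsmulHom P h (m ≫ f) a
    simp [gsmulHom]

/-- An extension of `B` by `Z` in the category of graded right `Λ`-modules: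
  a short exact sequence `0 → Z → E → B → 0`. -/
structure GExtension {P : C} (B Z : GradedModule P) where
  E : GradedModule P
  ι : GHom Z E
  ρ : GHom E B
  shortExact : IsShortExact ι ρ

/-- Two extensions are identified if there is a morphism of extensions between them
(such a morphism is automatically an isomorphism). -/
def GExtension.Rel {P : C} {B Z : GradedModule P} (e e' : GExtension B Z) : Prop :=
  ∃ φ : GHom e.E e'.E, φ.comp e.ι = e'.ι ∧ e'.ρ.comp φ = e.ρ

/-- `Ext¹_Λ(B, Z)`, realized as the set of equivalence classes of extensions
`0 → Z → E → B → 0` of graded right `Λ`-modules. -/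
def Ext1 {P : C} (B Z : GradedModule P) : Type _ :=
  Quot (GExtension.Rel (B := B) (Z := Z))

/-- Given `δ : Cc ⟶ ΣX`, the induced morphism of graded modules
`π_* Cc → (π_* X)[1]`, using the canonical identification `π_*(ΣX) ≅ (π_*X)[1]`. -/
noncomputable def triangleConnect (P : C) {X Cc : C} (δ : Cc ⟶ X⟦(1:ℤ)⟧) :
    GHom (piMod P Cc) (gshift 1 (piMod P X)) where
  app n := AddMonoidHom.mk' (fun u =>
    (shiftFunctorAdd' C n (-1) (n-1) (by omega)).hom.app P ≫ (u ≫ δ)⟦(-1:ℤ)⟧' ≫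
      (shiftFunctorCompIsoId C (1:ℤ) (-1) (by omega)).hom.app X) (fun u v => by
        simp [Preadditive.add_comp, Preadditive.comp_add, Functor.map_add])
  app_smul {n k l} h m a := by
    simp only [AddMonoidHom.mk'_apply]
    show (shiftFunctorAdd' C l (-1) (l-1) (by omega)).hom.app P ≫
        ((gsmulHom P h m a) ≫ δ)⟦(-1:ℤ)⟧' ≫
          (shiftFunctorCompIsoId C (1:ℤ) (-1) (by omega)).hom.app X =
      gsmulHom P (show (n-1) + k = l - 1 by omega)
        ((shiftFunctorAdd' C n (-1) (n-1) (by omega)).hom.app P ≫ (m ≫ δ)⟦(-1:ℤ)⟧' ≫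
          (shiftFunctorCompIsoId C (1:ℤ) (-1) (by omega)).hom.app X) a
    simp only [gsmulHom, Functor.map_comp, Category.assoc]
    have nat := ((shiftFunctorAdd' C n (-1) (n-1) (by omega : n + -1 = n - 1)).hom).naturality a
    dsimp at nat
    rw [reassoc_of% nat]
    rw [shiftFunctorAdd'_assoc_hom_app_assoc k n (-1) l (n-1) (l-1) (by omega) (by omega)
      (by omega) P]

section ExtGroups

instance {P : C} {M N : GradedModule P} : Add (GHom M N) :=
  ⟨fun f g =>
    { app := fun n => f.app n + g.app n
      app_smul := fun {n k l} h m a => by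
        show f.app l _ + g.app l _ = N.smul h (f.app n m + g.app n m) a
        rw [f.app_smul, g.app_smul, N.add_smulₓ] }⟩

instance {P : C} {M N : GradedModule P} : Neg (GHom M N) :=
  ⟨fun f =>
    { app := fun n => -(f.app n)
      app_smul := fun {n k l} h m a => by
        show -(f.app l _) = N.smul h (-(f.app n m)) a
        rw [f.app_smul]
        exact (map_neg (N.smulAddHom h a) _).symm }⟩

@[simp] theorem GHom.add_app {P : C} {M N : GradedModule P} (f g : GHom M N) (n : ℤ)
    (x : M.M n) : (f + g).app n x = f.app n x + g.app n x := rfl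

@[simp] theorem GHom.neg_app {P : C} {M N : GradedModule P} (f : GHom M N) (n : ℤ)
    (x : M.M n) : (-f).app n x = -(f.app n x) := rfl

instance {P : C} {M N : GradedModule P} : AddCommGroup (GHom M N) where
  add := (· + ·)
  zero := 0
  neg := Neg.neg
  add_assoc f g h := by ext n x; simp [add_assoc]
  zero_add f := by ext n x; simp
  add_zero f := by ext n x; simp
  add_comm f g := by ext n x; simp [add_comm]
  neg_add_cancel f := by ext n x; simp
  nsmul := nsmulRec
  zsmul := zsmulRec

/-- A projective resolution `⋯ → F₂ → F₁ → F₀ → B → 0` of a graded right `Λ`-module. -/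
structure ProjResolution {P : C} (B : GradedModule P) where
  F : ℕ → GradedModule P
  d : ∀ i : ℕ, GHom (F (i + 1)) (F i)
  aug : GHom (F 0) B
  projective : ∀ i, IsProjective (F i)
  aug_surjective : ∀ n : ℤ, Function.Surjective (aug.app n)
  exact_aug : ∀ (n : ℤ) (x : (F 0).M n), aug.app n x = 0 ↔ x ∈ Set.range ((d 0).app n)
  exact_d : ∀ (i : ℕ) (n : ℤ) (x : (F (i + 1)).M n),
    (d i).app n x = 0 ↔ x ∈ Set.range ((d (i + 1)).app n)

/-- The differential of the cochain complex `Hom_Λ(F_•, Z)` obtained by applying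
`Hom_Λ(−, Z)` to a projective resolution `F_•`. -/
def cochainD {P : C} {B : GradedModule P} (R : ProjResolution B) (Z : GradedModule P)
    (i : ℕ) : GHom (R.F i) Z →+ GHom (R.F (i + 1)) Z :=
  AddMonoidHom.mk' (fun f => f.comp (R.d i)) (fun f g => by ext n x; rfl)

/-- `Ext^{j+1}_Λ(B, Z)`, computed as the `(j+1)`-st cohomology
`ker(Hom(F_{j+1}, Z) → Hom(F_{j+2}, Z)) / im(Hom(F_j, Z) → Hom(F_{j+1}, Z))`
of the complex `Hom_Λ(F_•, Z)` for a projective resolution `F_• → B`. -/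
def extGroup {P : C} {B : GradedModule P} (R : ProjResolution B) (Z : GradedModule P)
    (j : ℕ) : Type v :=
  AddMonoidHom.ker (cochainD R Z (j + 1)) ⧸
    (AddMonoidHom.range (cochainD R Z j)).addSubgroupOf
      (AddMonoidHom.ker (cochainD R Z (j + 1)))

noncomputable instance {P : C} {B : GradedModule P} (R : ProjResolution B)
    (Z : GradedModule P) (j : ℕ) : AddCommGroup (extGroup R Z j) := by
  dsimp [extGroup]; infer_instance

end ExtGroups
section DG

/-- A differential graded right module over `Λ = End_T(P)_*`, where `Λ` is regarded as a
DG ring with zero differential: a graded right `Λ`-module together with a square-zero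
`Λ`-linear differential of degree `-1`. -/
structure DGMod (P : C) where
  gm : GradedModule P
  d : ∀ {n m : ℤ}, m + 1 = n → (gm.M n →+ gm.M m)
  d_sq : ∀ {n m j : ℤ} (h : m + 1 = n) (h' : j + 1 = m) (x : gm.M n), d h' (d h x) = 0
  d_smul : ∀ {n m j l l' : ℤ} (h : m + 1 = n) (hl : n + j = l) (hl' : l' + 1 = l)
    (hm : m + j = l') (x : gm.M n) (a : lam P j),
    d hl' (gm.smul hl x a) = gm.smul hm (d h x) a

/-- A morphism of DG `Λ`-modules: a morphism of the underlying graded modules commuting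
with the differentials. -/
structure DGHom {P : C} (M N : DGMod P) where
  g : GHom M.gm N.gm
  comm : ∀ {n m : ℤ} (h : m + 1 = n) (x : M.gm.M n),
    g.app m (M.d h x) = N.d h (g.app n x)

@[ext] theorem DGHom.ext {P : C} {M N : DGMod P} {f f' : DGHom M N}
    (h : ∀ (n : ℤ) (x : M.gm.M n), f.g.app n x = f'.g.app n x) : f = f' := by
  obtain ⟨fg, _⟩ := f; obtain ⟨fg', _⟩ := f'
  congr 1
  exact GHom.ext h

/-- The category of differential graded right `Λ`-modules. -/
instance dgModCategory (P : C) : Category (DGMod P) where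
  Hom M N := DGHom M N
  id M := ⟨GHom.id _, fun _ _ => rfl⟩
  comp f g := ⟨g.g.comp f.g, fun h x => by
    show g.g.app _ (f.g.app _ _) = _
    rw [f.comm, g.comm]
    rfl⟩
  id_comp f := by apply DGHom.ext; intros; rfl
  comp_id f := by apply DGHom.ext; intros; rfl
  assoc f g h := by apply DGHom.ext; intros; rfl

/-- The cycles `ker dₙ` of a DG module in degree `n`. -/
abbrev cycles {P : C} (M : DGMod P) (n : ℤ) : AddSubgroup (M.gm.M n) :=
  AddMonoidHom.ker (M.d (n := n) (m := n - 1) (by omega))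

/-- The boundaries `im d_{n+1}` of a DG module in degree `n`. -/
abbrev boundaries {P : C} (M : DGMod P) (n : ℤ) : AddSubgroup (M.gm.M n) :=
  AddMonoidHom.range (M.d (n := n + 1) (m := n) rfl)

/-- The homology `H_n M = ker dₙ / im d_{n+1}` of a DG module. -/
abbrev dgHomology {P : C} (M : DGMod P) (n : ℤ) : Type v :=
  cycles M n ⧸ (boundaries M n).addSubgroupOf (cycles M n)

/-- The map induced on cycles by a morphism of DG modules. -/
def cyclesMap {P : C} {M N : DGMod P} (f : M ⟶ N) (n : ℤ) : cycles M n →+ cycles N n :=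
  AddMonoidHom.codRestrict ((f.g.app n).comp (cycles M n).subtype) _ (fun x => by
    have hx : M.d (show (n - 1) + 1 = n by omega) x.1 = 0 := x.2
    have : N.d (show (n - 1) + 1 = n by omega) (f.g.app n x.1) = 0 := by
      rw [← f.comm (show (n - 1) + 1 = n by omega), hx, map_zero]
    exact this)

/-- The map induced on homology by a morphism of DG modules. -/
def dgHomologyMap {P : C} {M N : DGMod P} (f : M ⟶ N) (n : ℤ) :
    dgHomology M n →+ dgHomology N n :=
  QuotientAddGroup.map _ _ (cyclesMap f n) (by
    intro x hx
    have hx' : x.1 ∈ boundaries M n := hx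
    obtain ⟨y, hy⟩ := AddMonoidHom.mem_range.mp hx'
    have : (f.g.app n x.1) ∈ boundaries N n := by
      refine AddMonoidHom.mem_range.mpr ⟨f.g.app (n + 1) y, ?_⟩
      rw [← f.comm rfl y, hy]
    exact this)

/-- A quasi-isomorphism of DG modules: a morphism inducing an isomorphism on homology. -/
def quasiIso (P : C) : MorphismProperty (DGMod P) :=
  fun _ _ f => ∀ n : ℤ, Function.Bijective (dgHomologyMap f n)

/-- The derived category `D(Λ)` of the graded endomorphism ring `Λ = End_T(P)_*`
(regarded as a DG ring with zero differential): the localization of the category of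
DG right `Λ`-modules at the quasi-isomorphisms. -/
abbrev DerivedCat (P : C) := (quasiIso P).Localization

end DG


section GradedAlgebra

variable {P : C}

@[simp] theorem GHom.comp_app {M N K : GradedModule P} (g : GHom N K) (f : GHom M N) (n : ℤ)
    (x : M.M n) : (g.comp f).app n x = g.app n (f.app n x) := rfl

@[simp] theorem GHom.id_app {M : GradedModule P} (n : ℤ) (x : M.M n) :
    (GHom.id M).app n x = x := rfl

theorem GHom.congr_app {M N : GradedModule P} {f g : GHom M N} (h : f = g) (n : ℤ) (x : M.M n) :
    f.app n x = g.app n x := by rw [h]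

/-- The kernel of a morphism of graded modules. -/
@[reducible] def kerMod {M N : GradedModule P} (f : GHom M N) : GradedModule P where
  M n := (f.app n).ker
  smul h m a := ⟨M.smul h m.1 a, by
    rw [AddMonoidHom.mem_ker, f.app_smul, (AddMonoidHom.mem_ker).1 m.2, N.zero_smulₓ]⟩
  smul_addₓ h m a b := Subtype.ext (M.smul_addₓ h m.1 a b)
  add_smulₓ h m m' a := Subtype.ext (M.add_smulₓ h m.1 m'.1 a)
  smul_oneₓ m := Subtype.ext (M.smul_oneₓ m.1)
  smul_mulₓ h₁ h₂ h₃ h₄ m a b := Subtype.ext (M.smul_mulₓ h₁ h₂ h₃ h₄ m.1 a b)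

/-- The inclusion of the kernel of a morphism of graded modules. -/
def kerIncl {M N : GradedModule P} (f : GHom M N) : GHom (kerMod f) M where
  app n := (f.app n).ker.subtype
  app_smul _ _ _ := rfl

/-- The product of two graded modules. -/
@[reducible] def prodMod (M N : GradedModule P) : GradedModule P where
  M n := M.M n × N.M n
  smul h m a := (M.smul h m.1 a, N.smul h m.2 a)
  smul_addₓ h m a b := Prod.ext (M.smul_addₓ h m.1 a b) (N.smul_addₓ h m.2 a b)
  add_smulₓ h m m' a := Prod.ext (M.add_smulₓ h m.1 m'.1 a) (N.add_smulₓ h m.2 m'.2 a)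
  smul_oneₓ m := Prod.ext (M.smul_oneₓ m.1) (N.smul_oneₓ m.2)
  smul_mulₓ h₁ h₂ h₃ h₄ m a b :=
    Prod.ext (M.smul_mulₓ h₁ h₂ h₃ h₄ m.1 a b) (N.smul_mulₓ h₁ h₂ h₃ h₄ m.2 a b)

/-- The first projection of a product of graded modules. -/
def prodFst (M N : GradedModule P) : GHom (prodMod M N) M where
  app _ := AddMonoidHom.fst _ _
  app_smul _ _ _ := rfl

/-- The second projection of a product of graded modules. -/
def prodSnd (M N : GradedModule P) : GHom (prodMod M N) N where
  app _ := AddMonoidHom.snd _ _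
  app_smul _ _ _ := rfl

/-- The morphism into a product of graded modules with given components. -/
def prodLift {A M N : GradedModule P} (f : GHom A M) (g : GHom A N) : GHom A (prodMod M N) where
  app n := (f.app n).prod (g.app n)
  app_smul h m a := Prod.ext (f.app_smul h m a) (g.app_smul h m a)

theorem exists_lift_of_injective {A K M : GradedModule P} (ι : GHom K M)
    (hι : ∀ n, Function.Injective (ι.app n)) (f : GHom A M)
    (hf : ∀ n x, f.app n x ∈ Set.range (ι.app n)) :
    ∃ g : GHom A K, ι.comp g = f := by
  choose g hg using hf
  refine ⟨⟨fun n => AddMonoidHom.mk' (g n) fun x y => hι n ?_, fun h m a => hι _ ?_⟩, ?_⟩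
  · simp [hg]
  · simp only [AddMonoidHom.mk'_apply, hg, ι.app_smul, f.app_smul]
  · ext n x
    exact hg n x

theorem exists_desc_of_surjective {A B K : GradedModule P} (q : GHom A B) (hq : q.Surj)
    (r : GHom A K) (hr : ∀ n x, q.app n x = 0 → r.app n x = 0) :
    ∃ s : GHom B K, s.comp q = r := by
  choose t ht using hq
  have key : ∀ n x y, q.app n x = q.app n y → r.app n x = r.app n y := fun n x y h => by
    rw [← sub_eq_zero, ← map_sub]
    exact hr n _ (by rw [map_sub, h, sub_self])
  refine ⟨⟨fun n => AddMonoidHom.mk' (fun y => r.app n (t n y)) fun x y => ?_,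
    fun h m a => ?_⟩, ?_⟩
  · rw [← map_add]
    exact key _ _ _ (by simp [ht])
  · simp only [AddMonoidHom.mk'_apply]
    rw [← r.app_smul]
    exact key _ _ _ (by simp only [ht, q.app_smul])
  · ext n x
    exact key _ _ _ (ht _ _)

theorem IsShortExact.comp_app {Z E B : GradedModule P} {ι : GHom Z E} {ρ : GHom E B}
    (h : IsShortExact ι ρ) (n : ℤ) (x : Z.M n) : ρ.app n (ι.app n x) = 0 :=
  (h.exact n _).2 ⟨x, rfl⟩

/-- A short exact sequence with projective quotient splits. -/
theorem IsShortExact.exists_splitting {Z E B : GradedModule P} {ι : GHom Z E} {ρ : GHom E B}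
    (h : IsShortExact ι ρ) (hB : IsProjective B) :
    ∃ (s : GHom B E) (r : GHom E Z), (∀ n x, ρ.app n (s.app n x) = x) ∧
      (∀ n x, ι.app n (r.app n x) + s.app n (ρ.app n x) = x) ∧
      (∀ n x, r.app n (ι.app n x) = x) := by
  obtain ⟨s, hs⟩ := hB E B ρ h.epi (GHom.id B)
  have hs' : ∀ n x, ρ.app n (s.app n x) = x := fun n x => GHom.congr_app hs n x
  obtain ⟨r, hr⟩ := exists_lift_of_injective ι h.mono (GHom.id E + -(s.comp ρ)) fun n x =>
    (h.exact n _).1 (by simp [hs'])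
  have hr' : ∀ n x, ι.app n (r.app n x) + s.app n (ρ.app n x) = x := fun n x => by
    have := GHom.congr_app hr n x
    simp only [GHom.comp_app, GHom.add_app, GHom.id_app, GHom.neg_app] at this
    rw [this]
    abel
  refine ⟨s, r, hs', hr', fun n x => h.mono n ?_⟩
  have := hr' n (ι.app n x)
  rwa [h.comp_app, map_zero, add_zero] at this

theorem IsProjective.of_retract {A B : GradedModule P} (hA : IsProjective A) (i : GHom B A)
    (r : GHom A B) (h : ∀ n x, r.app n (i.app n x) = x) : IsProjective B := by
  intro D E e he f
  obtain ⟨g, hg⟩ := hA D E e he (f.comp r)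
  refine ⟨g.comp i, ?_⟩
  ext n x
  have := GHom.congr_app hg n (i.app n x)
  simpa [h] using this

theorem IsProjective.of_shortExact {Z E B : GradedModule P} {ι : GHom Z E} {ρ : GHom E B}
    (h : IsShortExact ι ρ) (hB : IsProjective B) (hZ : IsProjective Z) : IsProjective E := by
  obtain ⟨s, r, -, hsr, -⟩ := h.exists_splitting hB
  intro A D e he f
  obtain ⟨g₁, hg₁⟩ := hZ A D e he (f.comp ι)
  obtain ⟨g₂, hg₂⟩ := hB A D e he (f.comp s)
  refine ⟨g₁.comp r + g₂.comp ρ, ?_⟩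
  ext n x
  have h₁ := GHom.congr_app hg₁ n (r.app n x)
  have h₂ := GHom.congr_app hg₂ n (ρ.app n x)
  simp only [GHom.comp_app] at h₁ h₂
  simp only [GHom.comp_app, GHom.add_app, map_add, h₁, h₂]
  rw [← map_add, hsr]

theorem isShortExact_prod (M N : GradedModule P) :
    IsShortExact (prodLift (GHom.id M) 0) (prodSnd M N) where
  mono _ _ _ h := congrArg Prod.fst h
  epi n y := ⟨(0, y), rfl⟩
  exact n x := by
    constructor
    · intro h
      exact ⟨x.1, Prod.ext rfl h.symm⟩
    · rintro ⟨y, rfl⟩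
      rfl

theorem isShortExact_ker {M N : GradedModule P} (f : GHom M N) (hf : f.Surj) :
    IsShortExact (kerIncl f) f where
  mono n := Subtype.val_injective
  epi := hf
  exact n x := ⟨fun h => ⟨⟨x, h⟩, rfl⟩, by rintro ⟨y, rfl⟩; exact y.2⟩

/-- An extension of a projective module by a module of projective dimension `≤ d` has
projective dimension `≤ d`. -/
theorem projDimLE.of_shortExact_middle {d : ℕ} {Z E B : GradedModule P} {ι : GHom Z E}
    {ρ : GHom E B} (h : IsShortExact ι ρ) (hB : IsProjective B) (hZ : projDimLE d Z) :
    projDimLE d E := by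
  cases d with
  | zero => exact IsProjective.of_shortExact h hB hZ
  | succ d =>
    obtain ⟨F, K, ε, κ, hF, hse, hK⟩ := hZ
    obtain ⟨s, r, hs, hsr, -⟩ := h.exists_splitting hB
    let q : GHom (prodMod F B) E := (ι.comp ε).comp (prodFst F B) + s.comp (prodSnd F B)
    have hq : ∀ n x, q.app n x = ι.app n (ε.app n x.1) + s.app n x.2 := fun _ _ => rfl
    refine ⟨prodMod F B, K, q,
      prodLift κ 0, IsProjective.of_shortExact (isShortExact_prod F B) hB hF, ⟨?_, ?_, ?_⟩, hK⟩
    · intro n x y hxy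
      exact hse.mono n (congrArg Prod.fst hxy)
    · intro n x
      obtain ⟨y, hy⟩ := hse.epi n (r.app n x)
      exact ⟨(y, ρ.app n x), by rw [hq, hy, hsr]⟩
    · rintro n ⟨x, y⟩
      rw [hq]
      constructor
      · intro hxy
        have hy : y = 0 := by
          have := congrArg (ρ.app n) hxy
          simpa [h.comp_app, hs] using this
        subst hy
        have hx : ε.app n x = 0 := h.mono n (by simpa using hxy)
        obtain ⟨k, rfl⟩ := (hse.exact n x).1 hx
        exact ⟨k, rfl⟩
      · rintro ⟨k, hk⟩
        obtain ⟨rfl, rfl⟩ := Prod.mk.inj hk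
        rw [GHom.zero_app, hse.comp_app, map_zero, map_zero, add_zero]

/-- The kernel of a surjection of a module of projective dimension `≤ d` onto a projective
module has projective dimension `≤ d`. -/
theorem projDimLE.of_shortExact_left {d : ℕ} {Z E B : GradedModule P} {ι : GHom Z E}
    {ρ : GHom E B} (h : IsShortExact ι ρ) (hB : IsProjective B) (hE : projDimLE d E) :
    projDimLE d Z := by
  cases d with
  | zero =>
    obtain ⟨s, r, -, -, hr⟩ := h.exists_splitting hB
    exact IsProjective.of_retract hE ι r hr
  | succ d =>
    obtain ⟨F, K, ε, κ, hF, hse, hK⟩ := hE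
    have hL := isShortExact_ker (ρ.comp ε) fun n => (h.epi n).comp (hse.epi n)
    obtain ⟨-, r, -, -, hr⟩ := hL.exists_splitting hB
    obtain ⟨η, hη⟩ := exists_lift_of_injective ι h.mono (ε.comp (kerIncl (ρ.comp ε)))
      fun n x => (h.exact n _).1 x.2
    obtain ⟨μ, hμ⟩ := exists_lift_of_injective (kerIncl (ρ.comp ε)) hL.mono κ
      fun n x => ⟨⟨κ.app n x, by simp [hse.comp_app]⟩, rfl⟩
    have hη' : ∀ n x, ι.app n (η.app n x) = ε.app n x.1 := GHom.congr_app hη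
    have hμ' : ∀ n x, (μ.app n x).1 = κ.app n x := GHom.congr_app hμ
    refine ⟨kerMod (ρ.comp ε), K, η, μ, IsProjective.of_retract hF _ r hr, ⟨?_, ?_, ?_⟩, hK⟩
    · intro n x y hxy
      exact hse.mono n (by rw [← hμ', ← hμ', hxy])
    · intro n z
      obtain ⟨x, hx⟩ := hse.epi n (ι.app n z)
      refine ⟨⟨x, by simp [hx, h.comp_app]⟩, h.mono n ?_⟩
      rw [hη', hx]
    · intro n x
      rw [← (injective_iff_map_eq_zero' _).1 (h.mono n), hη', hse.exact]
      constructor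
      · rintro ⟨k, hk⟩
        exact ⟨k, Subtype.ext ((hμ' n k).trans hk)⟩
      · rintro ⟨k, rfl⟩
        exact ⟨k, (hμ' n k).symm⟩

/-- The kernel of any surjection from a projective module onto a module of projective dimension
`≤ d + 1` has projective dimension `≤ d`. -/
theorem projDimLE.of_shortExact_projective {d : ℕ} {K F M : GradedModule P} {ι : GHom K F}
    {ε : GHom F M} (h : IsShortExact ι ε) (hF : IsProjective F) (hM : projDimLE (d + 1) M) :
    projDimLE d K := by
  obtain ⟨F', K', ε', ι', hF', h', hK'⟩ := hM
  let q : GHom (prodMod F F') M := ε.comp (prodFst F F') + -(ε'.comp (prodSnd F F'))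
  have hq : ∀ n x, q.app n x = 0 ↔ ε.app n x.1 = ε'.app n x.2 := fun n x => by
    rw [← sub_eq_zero (a := ε.app n x.1), sub_eq_add_neg]
    rfl
  let p := (prodFst F F').comp (kerIncl q)
  let p' := (prodSnd F F').comp (kerIncl q)
  obtain ⟨i, hi⟩ := exists_lift_of_injective (kerIncl q) (fun n => Subtype.val_injective)
    (prodLift ι 0) fun n x => ⟨⟨(ι.app n x, 0), (hq _ _).2 (by simp [h.comp_app])⟩, rfl⟩
  obtain ⟨i', hi'⟩ := exists_lift_of_injective (kerIncl q) (fun n => Subtype.val_injective)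
    (prodLift 0 ι') fun n x => ⟨⟨(0, ι'.app n x), (hq _ _).2 (by simp [h'.comp_app])⟩, rfl⟩
  replace hi : ∀ n x, (i.app n x).1 = (ι.app n x, 0) := GHom.congr_app hi
  replace hi' : ∀ n x, (i'.app n x).1 = (0, ι'.app n x) := GHom.congr_app hi'
  have hp : IsShortExact i' p := by
    refine ⟨fun n x y hxy => h'.mono n ?_, fun n x => ?_, fun n x => ⟨fun hx => ?_, ?_⟩⟩
    · have := congrArg (fun t => t.1.2) hxy
      simpa [hi'] using this
    · obtain ⟨y, hy⟩ := h'.epi n (ε.app n x)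
      exact ⟨⟨(x, y), (hq _ _).2 hy.symm⟩, rfl⟩
    · have hx0 : x.1.1 = 0 := hx
      have hx1 := (hq n x.1).1 x.2
      rw [hx0, map_zero] at hx1
      obtain ⟨y, hy⟩ := (h'.exact n _).1 hx1.symm
      exact ⟨y, Subtype.ext ((hi' n y).trans (Prod.ext hx0.symm hy))⟩
    · rintro ⟨y, rfl⟩
      exact congrArg Prod.fst (hi' n y)
  have hp' : IsShortExact i p' := by
    refine ⟨fun n x y hxy => h.mono n ?_, fun n x => ?_, fun n x => ⟨fun hx => ?_, ?_⟩⟩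
    · have := congrArg (fun t => t.1.1) hxy
      simpa [hi] using this
    · obtain ⟨y, hy⟩ := h.epi n (ε'.app n x)
      exact ⟨⟨(y, x), (hq _ _).2 hy⟩, rfl⟩
    · have hx0 : x.1.2 = 0 := hx
      have hx1 := (hq n x.1).1 x.2
      rw [hx0, map_zero] at hx1
      obtain ⟨y, hy⟩ := (h.exact n _).1 hx1
      exact ⟨y, Subtype.ext ((hi n y).trans (Prod.ext hy hx0.symm))⟩
    · rintro ⟨y, rfl⟩
      exact congrArg Prod.snd (hi n y)
  exact projDimLE.of_shortExact_left hp' hF' (projDimLE.of_shortExact_middle hp hF hK')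

/-- A morphism of extensions is bijective, so the relation it defines is symmetric. -/
theorem GExtension.Rel.symm {B Z : GradedModule P} {e e' : GExtension B Z} (h : e.Rel e') :
    e'.Rel e := by
  obtain ⟨φ, hι, hρ⟩ := h
  have hι' : ∀ n x, φ.app n (e.ι.app n x) = e'.ι.app n x := GHom.congr_app hι
  have hρ' : ∀ n x, e'.ρ.app n (φ.app n x) = e.ρ.app n x := GHom.congr_app hρ
  have hinj : ∀ n x, φ.app n x = 0 → x = 0 := fun n x hx => by
    have h0 := hρ' n x
    rw [hx, map_zero] at h0
    obtain ⟨z, rfl⟩ := (e.shortExact.exact n x).1 h0.symm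
    rw [hι'] at hx
    rw [e'.shortExact.mono n (hx.trans (map_zero _).symm), map_zero]
  have hsurj : φ.Surj := fun n y => by
    obtain ⟨x, hx⟩ := e.shortExact.epi n (e'.ρ.app n y)
    obtain ⟨z, hz⟩ := (e'.shortExact.exact n (y - φ.app n x)).1
      (by rw [map_sub, hρ', hx, sub_self])
    exact ⟨x + e.ι.app n z, by rw [map_add, hι', hz]; abel⟩
  obtain ⟨ψ, hψ⟩ := exists_desc_of_surjective φ hsurj (GHom.id _) hinj
  have hψ' : ∀ n x, ψ.app n (φ.app n x) = x := GHom.congr_app hψ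
  refine ⟨ψ, ?_, ?_⟩
  · ext n x
    rw [GHom.comp_app, ← hι', hψ']
  · ext n x
    obtain ⟨y, rfl⟩ := hsurj n x
    rw [GHom.comp_app, hψ', hρ']

theorem GExtension.rel_of_mk_eq {B Z : GradedModule P} {e e' : GExtension B Z}
    (h : Quot.mk GExtension.Rel e = Quot.mk GExtension.Rel e') : e.Rel e' := by
  have h' := Quot.eqvGen_exact h
  clear h
  induction h' with
  | rel _ _ h => exact h
  | refl e => exact ⟨GHom.id _, rfl, rfl⟩
  | symm _ _ _ ih => exact ih.symm
  | trans _ _ _ _ _ ih ih' =>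
    obtain ⟨φ, h₁, h₂⟩ := ih
    obtain ⟨ψ, h₃, h₄⟩ := ih'
    exact ⟨ψ.comp φ, by rw [← h₃, ← h₁]; rfl, by rw [← h₂, ← h₄]; rfl⟩

end GradedAlgebra

section Shift

/-- The identification `Hom(Σⁿ P, Σᵏ X) ≅ Hom(Σⁿ⁻ᵏ P, X)`. -/
def unshift (P : C) {X : C} {n m k j : ℤ} (h : n + j = m) (hk : k + j = 0)
    (u : P⟦n⟧ ⟶ X⟦k⟧) : P⟦m⟧ ⟶ X :=
  (shiftFunctorAdd' C n j m h).hom.app P ≫ u⟦j⟧' ≫ (shiftFunctorCompIsoId C k j hk).hom.app X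

theorem unshift_bijective (P : C) {X : C} {n m k j : ℤ} (h : n + j = m) (hk : k + j = 0) :
    Function.Bijective (unshift P h hk (X := X)) := by
  constructor
  · intro u v huv
    simp only [unshift, cancel_epi, cancel_mono] at huv
    exact (shiftFunctor C j).map_injective huv
  · intro w
    obtain ⟨u, hu⟩ := (shiftFunctor C j).map_surjective
      ((shiftFunctorAdd' C n j m h).inv.app P ≫ w ≫ (shiftFunctorCompIsoId C k j hk).inv.app X)
    exact ⟨u, by simp [unshift, hu]⟩

theorem unshift_zero (P : C) {X : C} {n m k j : ℤ} (h : n + j = m) (hk : k + j = 0) :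
    unshift P h hk (0 : P⟦n⟧ ⟶ X⟦k⟧) = 0 := by
  simp [unshift]

theorem unshift_comp (P : C) {X Y : C} {n m k j : ℤ} (h : n + j = m) (hk : k + j = 0)
    (u : P⟦n⟧ ⟶ X⟦k⟧) (f : X ⟶ Y) : unshift P h hk (u ≫ f⟦k⟧') = unshift P h hk u ≫ f := by
  have := (shiftFunctorCompIsoId C k j hk).hom.naturality f
  dsimp at this
  simp [unshift, this]

theorem triangleConnect_app (P : C) {X Z : C} (δ : Z ⟶ X⟦(1:ℤ)⟧) (n : ℤ) (u : P⟦n⟧ ⟶ Z) :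
    (triangleConnect P δ).app n u =
      unshift P (show n + -1 = n - 1 by omega) (show (1 : ℤ) + -1 = 0 by omega) (u ≫ δ) := rfl

@[simp] theorem piGHom_app (P : C) {X Y : C} (f : X ⟶ Y) (n : ℤ) (u : P⟦n⟧ ⟶ X) :
    (piGHom P f).app n u = u ≫ f := rfl

theorem triangleConnect_app_eq_zero_iff (P : C) {X Z : C} (δ : Z ⟶ X⟦(1:ℤ)⟧) (n : ℤ)
    (u : P⟦n⟧ ⟶ Z) : (triangleConnect P δ).app n u = 0 ↔ u ≫ δ = 0 := by
  rw [triangleConnect_app]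
  exact (unshift_bijective P _ _).injective.eq_iff' (unshift_zero P _ _)

theorem InDegrees.shift {P Z : C} {N : ℕ} {i j : ZMod N} (hZ : InDegrees N i (piMod P Z))
    (k : ℤ) (h : i + k = j) : InDegrees N j (piMod P (Z⟦k⟧)) := by
  intro n hn u
  apply (unshift_bijective P (show n + -k = n - k by omega) (show k + -k = 0 by omega)).injective
  rw [unshift_zero]
  refine hZ (n - k) (fun h' => hn ?_) _
  rw [← h, ← h']
  push_cast
  ring

theorem gsmulHom_comp (P : C) {X Y : C} {n k l : ℤ} (h : n + k = l) (m : P⟦n⟧ ⟶ X)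
    (a : lam P k) (f : X ⟶ Y) : gsmulHom P h m a ≫ f = gsmulHom P h (m ≫ f) a := by
  simp [gsmulHom]

theorem gsmulHom_id_bijective (P : C) {n k l : ℤ} (h : n + k = l) :
    Function.Bijective (gsmulHom P h (𝟙 (P⟦n⟧))) := by
  constructor
  · intro u v huv
    simp only [gsmulHom, cancel_epi, cancel_mono] at huv
    exact (shiftFunctor C n).map_injective huv
  · intro w
    obtain ⟨u, hu⟩ := (shiftFunctor C n).map_surjective
      ((shiftFunctorAdd' C k n l (by omega)).inv.app P ≫ w)
    exact ⟨u, by simp [gsmulHom, hu]⟩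

theorem Sparse.hom_eq_zero {P : C} {N : ℕ} (hsp : Sparse P N) {n m : ℤ}
    (h : (n : ZMod N) ≠ m) (u : P⟦n⟧ ⟶ P⟦m⟧) : u = 0 := by
  obtain ⟨a, rfl⟩ := (gsmulHom_id_bijective P (show m + (n - m) = n by omega)).surjective u
  rw [hsp (n - m) (fun hd => h ?_) a]
  · simp [gsmulHom]
  · rw [← sub_eq_zero, ← Int.cast_sub]
    exact (ZMod.intCast_zmod_eq_zero_iff_dvd _ _).2 hd

/-- The graded module `π_*(Σᵐ P)` is free on the generator `𝟙` of degree `m`. -/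
theorem exists_piMod_shift_hom (P : C) (A : GradedModule P) {m : ℤ} (a : A.M m) :
    ∃ φ : GHom (piMod P (P⟦m⟧)) A, φ.app m (𝟙 (P⟦m⟧)) = a := by
  have hd : ∀ n : ℤ, m + (n - m) = n := fun n => by omega
  let e : ∀ n : ℤ, lam P (n - m) → (P⟦n⟧ ⟶ P⟦m⟧) := fun n => gsmulHom P (hd n) (𝟙 _)
  have he : ∀ n, Function.Bijective (e n) := fun n => gsmulHom_id_bijective P (hd n)
  choose c hc using fun n => (he n).surjective
  have key : ∀ {n k : ℤ} (h : m + k = n) (b : lam P k),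
      A.smul (hd n) a (c n (gsmulHom P h (𝟙 _) b)) = A.smul h a b := by
    intro n k h b
    obtain rfl : k = n - m := by omega
    rw [(he n).injective (hc n (gsmulHom P h (𝟙 _) b))]
  refine ⟨⟨fun n => AddMonoidHom.mk' (fun u => A.smul (hd n) a (c n u)) fun u w => ?_,
    fun {n k l} h u b => ?_⟩, ?_⟩
  · rw [← A.smul_addₓ]
    congr 1
    apply (he n).injective
    rw [hc]
    exact (congrArg₂ (· + ·) (hc n u) (hc n w)).symm.trans
      ((piMod P (P⟦m⟧)).smul_addₓ (hd n) (𝟙 _) _ _).symm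
  · simp only [AddMonoidHom.mk'_apply]
    rw [A.smul_mulₓ (hd n) (show n - m + k = l - m by omega) h (hd l)]
    congr 1
    apply (he l).injective
    rw [hc]
    refine Eq.trans ?_ ((piMod P (P⟦m⟧)).smul_mulₓ (hd n) (show n - m + k = l - m by omega) h
      (hd l) (𝟙 _) (c n u) b)
    exact congrArg (fun t => gsmulHom P h t b) (hc n u).symm
  · have h₁ := key (add_zero m) (gone P)
    have h₂ : gsmulHom P (add_zero m) (𝟙 (P⟦m⟧)) (gone P) = 𝟙 _ :=
      (piMod P (P⟦m⟧)).smul_oneₓ (𝟙 _)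
    rw [h₂, A.smul_oneₓ] at h₁
    exact h₁

end Shift

section Coproducts

variable [HasCoproducts.{v} C]

@[simp] theorem compactComparison_of (P : C) {ι : Type v} [DecidableEq ι] (X : ι → C) (i : ι)
    (w : P ⟶ X i) :
    compactComparison P X (DirectSum.of (fun i => P ⟶ X i) i w) = w ≫ Sigma.ι X i := by
  unfold compactComparison
  convert DirectSum.toAddMonoid_of
    (fun j => AddMonoidHom.mk' (fun f : P ⟶ X j => f ≫ Sigma.ι X j)
      fun _ _ => Preadditive.add_comp _ _ _ _ _ _) i w
  rfl

theorem compactComparison_injective (P : C) {ι : Type v} (X : ι → C) :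
    Function.Injective (compactComparison P X) := by
  classical
  rw [injective_iff_map_eq_zero]
  intro x hx
  have key : ∀ (y : ⨁ i, (P ⟶ X i)) (j : ι), compactComparison P X y ≫
      Sigma.desc (fun i => if h : i = j then eqToHom (by rw [h]) else 0) = y j := by
    intro y j
    induction y using DirectSum.induction_on with
    | zero => simp
    | of i w =>
      simp only [compactComparison_of, Category.assoc, colimit.ι_desc, Cofan.mk_ι_app]
      split_ifs with h
      · subst h
        simp
      · rw [DirectSum.of_eq_of_ne _ _ _ (Ne.symm h), comp_zero]
    | add y z hy hz => rw [map_add, Preadditive.add_comp, hy, hz, DirectSum.add_apply]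
  ext j
  rw [← key, hx, zero_comp]
  rfl

/-- The shifts of a compact object are compact. -/
theorem IsCompactObj.shift {P : C} (hP : IsCompactObj P) (n : ℤ) : IsCompactObj (P⟦n⟧) := by
  classical
  refine fun ι X => ⟨compactComparison_injective _ _, fun u => ?_⟩
  have key : ∀ x : ⨁ i, (P ⟶ (X i)⟦-n⟧), ∃ y : ⨁ i, (P⟦n⟧ ⟶ X i),
      (shiftFunctorCompIsoId C n (-n) (by omega)).hom.app P ≫
        compactComparison P (fun i => (X i)⟦-n⟧) x ≫ sigmaComparison (shiftFunctor C (-n)) X =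
      (compactComparison (P⟦n⟧) X y)⟦-n⟧' := by
    intro x
    induction x using DirectSum.induction_on with
    | zero => exact ⟨0, by simp⟩
    | of i w =>
      obtain ⟨w', hw'⟩ := (shiftFunctor C (-n)).map_surjective
        ((shiftFunctorCompIsoId C n (-n) (by omega)).hom.app P ≫ w)
      exact ⟨DirectSum.of _ i w', by simp [hw']⟩
    | add x₁ x₂ h₁ h₂ =>
      obtain ⟨y₁, h₁⟩ := h₁
      obtain ⟨y₂, h₂⟩ := h₂
      exact ⟨y₁ + y₂, by simp [Preadditive.add_comp, Preadditive.comp_add, h₁, h₂,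
        Functor.map_add]⟩
  obtain ⟨x, hx⟩ := (hP ι fun i => (X i)⟦-n⟧).surjective
    ((shiftFunctorCompIsoId C n (-n) (by omega)).inv.app P ≫ u⟦-n⟧' ≫
      inv (sigmaComparison (shiftFunctor C (-n)) X))
  obtain ⟨y, hy⟩ := key x
  refine ⟨y, (shiftFunctor C (-n)).map_injective ?_⟩
  rw [← hy, hx]
  simp

theorem IsCompactObj.induction {P : C} (hP : IsCompactObj P) {ι : Type v} (X : ι → C) {n : ℤ}
    {p : (P⟦n⟧ ⟶ ∐ X) → Prop} (zero : p 0) (add : ∀ u w, p u → p w → p (u + w))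
    (of : ∀ i (w : P⟦n⟧ ⟶ X i), p (w ≫ Sigma.ι X i)) (u : P⟦n⟧ ⟶ ∐ X) : p u := by
  classical
  obtain ⟨x, rfl⟩ := (hP.shift n ι X).surjective u
  induction x using DirectSum.induction_on with
  | zero => simpa using zero
  | of i w => simpa using of i w
  | add x y hx hy => simpa using add _ _ hx hy

theorem IsCompactObj.ghom_ext {P : C} (hP : IsCompactObj P) {ι : Type v} {X : ι → C}
    {A : GradedModule P} {φ ψ : GHom (piMod P (∐ X)) A}
    (h : ∀ i, φ.comp (piGHom P (Sigma.ι X i)) = ψ.comp (piGHom P (Sigma.ι X i))) : φ = ψ := by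
  ext n u
  induction u using hP.induction with
  | zero => exact (map_zero _).trans (map_zero _).symm
  | add u w hu hw => exact (map_add _ _ _).trans ((congrArg₂ _ hu hw).trans (map_add _ _ _).symm)
  | of i w => exact GHom.congr_app (h i) n w

theorem IsCompactObj.exists_ghom {P : C} (hP : IsCompactObj P) {ι : Type v} {X : ι → C}
    {A : GradedModule P} (φ : ∀ i, GHom (piMod P (X i)) A) :
    ∃ ψ : GHom (piMod P (∐ X)) A, ∀ i, ψ.comp (piGHom P (Sigma.ι X i)) = φ i := by
  classical
  let e : ∀ n : ℤ, (⨁ i, (P⟦n⟧ ⟶ X i)) ≃+ (P⟦n⟧ ⟶ ∐ X) := fun n =>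
    AddEquiv.ofBijective (compactComparison (P⟦n⟧) X) (hP.shift n ι X)
  let ψ : ∀ n : ℤ, (P⟦n⟧ ⟶ ∐ X) →+ A.M n := fun n =>
    (DirectSum.toAddMonoid fun i => (φ i).app n).comp (e n).symm.toAddMonoidHom
  have hψ : ∀ n i (w : P⟦n⟧ ⟶ X i), ψ n (w ≫ Sigma.ι X i) = (φ i).app n w := by
    intro n i w
    have : (e n).symm (w ≫ Sigma.ι X i) = DirectSum.of (fun i => P⟦n⟧ ⟶ X i) i w := by
      rw [AddEquiv.symm_apply_eq]
      exact (compactComparison_of _ _ _ _).symm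
    simp only [ψ, AddMonoidHom.comp_apply, AddEquiv.toAddMonoidHom_eq_coe,
      AddMonoidHom.coe_coe, this, DirectSum.toAddMonoid_of]
  refine ⟨⟨ψ, fun {n k l} h u a => ?_⟩, fun i => ?_⟩
  · induction u using hP.induction with
    | zero => rw [(piMod P (∐ X)).zero_smulₓ, map_zero, map_zero, A.zero_smulₓ]
    | add u w hu hw => rw [(piMod P (∐ X)).add_smulₓ, map_add, map_add, A.add_smulₓ, hu, hw]
    | of i w =>
      rw [hψ, ← (φ i).app_smul, ← hψ]
      congr 1
      exact (gsmulHom_comp P h w a _).symm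
  · ext n w
    exact hψ n i w

end Coproducts

section FreeCover

variable [HasCoproducts.{v} C]

theorem ghom_shift_ext {P : C} {A : GradedModule P} {m : ℤ} {φ ψ : GHom (piMod P (P⟦m⟧)) A}
    (h : φ.app m (𝟙 (P⟦m⟧)) = ψ.app m (𝟙 (P⟦m⟧))) : φ = ψ := by
  ext n u
  have hd : m + (n - m) = n := by omega
  obtain ⟨a, rfl⟩ := (gsmulHom_id_bijective P hd).surjective u
  exact (φ.app_smul hd (𝟙 _) a).trans ((congrArg (fun t => A.smul hd t a) h).trans
    (ψ.app_smul hd (𝟙 _) a).symm)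

theorem IsCompactObj.ghom_ext_free {P : C} (hP : IsCompactObj P) {ι : Type v} {deg : ι → ℤ}
    {A : GradedModule P} {φ ψ : GHom (piMod P (∐ fun i => P⟦deg i⟧)) A}
    (h : ∀ i, φ.app (deg i) (Sigma.ι (fun i => P⟦deg i⟧) i) =
      ψ.app (deg i) (Sigma.ι (fun i => P⟦deg i⟧) i)) : φ = ψ :=
  hP.ghom_ext fun i => ghom_shift_ext <| by
    rw [GHom.comp_app, GHom.comp_app, piGHom_app, Category.id_comp]
    exact h i

theorem IsCompactObj.exists_ghom_free {P : C} (hP : IsCompactObj P) {ι : Type v} {deg : ι → ℤ}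
    {A : GradedModule P} (a : ∀ i, A.M (deg i)) :
    ∃ ψ : GHom (piMod P (∐ fun i => P⟦deg i⟧)) A,
      ∀ i, ψ.app (deg i) (Sigma.ι (fun i => P⟦deg i⟧) i) = a i := by
  choose φ hφ using fun i => exists_piMod_shift_hom P A (a i)
  obtain ⟨ψ, hψ⟩ := hP.exists_ghom φ
  exact ⟨ψ, fun i => by
    rw [← hφ, ← hψ, GHom.comp_app, piGHom_app, Category.id_comp]⟩

/-- Every object with homotopy in `B[j]` receives a map, surjective on homotopy, from a
coproduct of shifts of `P` whose homotopy is in `B[j]`. -/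
theorem IsCompactObj.exists_cover {P : C} (hP : IsCompactObj P) {N : ℕ} (hsp : Sparse P N)
    {j : ZMod N} {X : C} (hX : InDegrees N j (piMod P X)) :
    ∃ (Q : C) (p : Q ⟶ X), InDegrees N j (piMod P Q) ∧ IsProjective (piMod P Q) ∧
      (piGHom P p).Surj ∧ ∀ Z : C, Function.Bijective fun f : Q ⟶ Z => piGHom P f := by
  let ι : Type v := Σ n : {n : ℤ // (n : ZMod N) = j}, (P⟦n.1⟧ ⟶ X)
  let deg : ι → ℤ := fun i => i.1.1
  refine ⟨∐ fun i : ι => P⟦deg i⟧, Sigma.desc fun i => i.2, ?_, ?_, ?_, ?_⟩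
  · intro n hn u
    induction u using hP.induction with
    | zero => rfl
    | add u w hu hw => exact (congrArg₂ (· + ·) hu hw).trans (add_zero _)
    | of i w =>
      rw [hsp.hom_eq_zero (fun h => hn (h.trans i.1.2)) w, zero_comp]
  · intro A B e he f
    choose a ha using fun i : ι => he (deg i) (f.app (deg i) (Sigma.ι (fun i => P⟦deg i⟧) i))
    obtain ⟨g, hg⟩ := hP.exists_ghom_free a
    exact ⟨g, hP.ghom_ext_free fun i => by rw [GHom.comp_app, hg, ha]⟩
  · intro n u
    by_cases hn : (n : ZMod N) = j
    · exact ⟨Sigma.ι (fun i => P⟦deg i⟧) (⟨⟨n, hn⟩, u⟩ : ι), Sigma.ι_desc _ _⟩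
    · exact ⟨0, by rw [map_zero]; exact (hX n hn u).symm⟩
  · intro Z
    constructor
    · intro f g hfg
      refine Sigma.hom_ext _ _ fun i => ?_
      exact GHom.congr_app hfg (deg i) (Sigma.ι (fun i => P⟦deg i⟧) i)
    · intro φ
      refine ⟨Sigma.desc fun i => φ.app (deg i) (Sigma.ι (fun i => P⟦deg i⟧) i),
        hP.ghom_ext_free fun i => Sigma.ι_desc _ _⟩

end FreeCover

section Triangles

theorem piGHom_comp (P : C) {X Y Z : C} (f : X ⟶ Y) (g : Y ⟶ Z) :
    (piGHom P g).comp (piGHom P f) = piGHom P (f ≫ g) := by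
  ext n u
  exact Category.assoc _ _ _

theorem piGHom_zero (P X Y : C) : piGHom P (0 : X ⟶ Y) = 0 := by
  ext n u
  exact comp_zero

theorem isShortExact_of_piGHom_eq_zero (P : C) {X Y Z : C} {f : X ⟶ Y} {g : Y ⟶ Z}
    {δ : Z ⟶ X⟦(1 : ℤ)⟧} (hT : Triangle.mk f g δ ∈ distTriang C)
    (hf : ∀ (n : ℤ) (u : P⟦n⟧ ⟶ X), u ≫ f = 0) :
    IsShortExact (piGHom P g) (triangleConnect P δ) where
  mono n := by
    rw [injective_iff_map_eq_zero]
    intro u hu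
    obtain ⟨w, rfl⟩ := Triangle.coyoneda_exact₂ _ hT u hu
    exact hf n w
  epi n v := by
    obtain ⟨u, rfl⟩ := (unshift_bijective P (show n + -1 = n - 1 by omega)
      (show (1 : ℤ) + -1 = 0 by omega) (X := X)).surjective v
    have hu : u ≫ f⟦(1 : ℤ)⟧' = 0 := by
      apply (unshift_bijective P (show n + -1 = n - 1 by omega)
        (show (1 : ℤ) + -1 = 0 by omega)).injective
      rw [unshift_comp, hf, unshift_zero]
    obtain ⟨w, rfl⟩ := Triangle.coyoneda_exact₁ _ hT u hu
    exact ⟨w, rfl⟩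
  exact n u := by
    rw [triangleConnect_app_eq_zero_iff]
    constructor
    · intro hu
      obtain ⟨w, rfl⟩ := Triangle.coyoneda_exact₃ _ hT u hu
      exact ⟨w, rfl⟩
    · rintro ⟨w, rfl⟩
      have hgδ : g ≫ δ = 0 := comp_distTriang_mor_zero₂₃ _ hT
      exact (Category.assoc _ _ _).trans ((congrArg (w ≫ ·) hgδ).trans comp_zero)

theorem isShortExact_of_surj_mor₂ (P : C) {K Q X : C} {j : K ⟶ Q} {p : Q ⟶ X}
    {d : X ⟶ K⟦(1 : ℤ)⟧} (hT : Triangle.mk j p d ∈ distTriang C) (hp : (piGHom P p).Surj) :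
    IsShortExact (piGHom P j) (piGHom P p) where
  mono n := by
    rw [injective_iff_map_eq_zero]
    intro u hu
    have hu' : u⟦(1 : ℤ)⟧' ≫ j⟦(1 : ℤ)⟧' = 0 := by
      rw [← Functor.map_comp]
      exact (congrArg (fun t => t⟦(1 : ℤ)⟧') hu).trans (Functor.map_zero _ _ _)
    obtain ⟨g, (hg : u⟦(1 : ℤ)⟧' = g ≫ d)⟩ := Triangle.coyoneda_exact₁ _ hT _ hu'
    obtain ⟨w, hw⟩ := hp (n + 1) ((shiftFunctorAdd' C n 1 (n + 1) rfl).hom.app P ≫ g)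
    rw [piGHom_app] at hw
    have hpd : p ≫ d = 0 := comp_distTriang_mor_zero₂₃ _ hT
    apply (shiftFunctor C (1 : ℤ)).map_injective
    rw [← cancel_epi ((shiftFunctorAdd' C n 1 (n + 1) rfl).hom.app P), hg, Functor.map_zero,
      comp_zero]
    exact (Category.assoc _ _ _).symm.trans ((congrArg (· ≫ d) hw).symm.trans
      ((Category.assoc _ _ _).trans ((congrArg (w ≫ ·) hpd).trans comp_zero)))
  epi := hp
  exact n u := by
    constructor
    · intro hu
      obtain ⟨w, rfl⟩ := Triangle.coyoneda_exact₂ _ hT u hu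
      exact ⟨w, rfl⟩
    · rintro ⟨w, rfl⟩
      have hjp : j ≫ p = 0 := comp_distTriang_mor_zero₁₂ _ hT
      exact (Category.assoc _ _ _).trans ((congrArg (w ≫ ·) hjp).trans comp_zero)

theorem injective_of_surj_mor₃ (P : C) {X W V : C} {d : X ⟶ W} {a : W ⟶ V}
    {b : V ⟶ X⟦(1 : ℤ)⟧} (hT : Triangle.mk d a b ∈ distTriang C) (hb : (piGHom P b).Surj)
    (n : ℤ) : Function.Injective ((piGHom P a).app n) := by
  rw [injective_iff_map_eq_zero]
  intro u hu
  obtain ⟨w, hw⟩ : ∃ w : P⟦n⟧ ⟶ X, u = w ≫ d := Triangle.coyoneda_exact₂ _ hT u hu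
  obtain ⟨w', rfl⟩ := (unshift_bijective P (show n + 1 + -1 = n by omega)
    (show (1 : ℤ) + -1 = 0 by omega) (X := X)).surjective w
  obtain ⟨y, rfl⟩ := hb _ w'
  have hbd : b ≫ d⟦(1 : ℤ)⟧' = 0 := comp_distTriang_mor_zero₃₁ _ hT
  rw [hw, ← unshift_comp, piGHom_app, Category.assoc, hbd, comp_zero, unshift_zero]

theorem IsGenerator.isIso_of_bijective {P : C} (hgen : IsGenerator P) {X Y : C} (w : X ⟶ Y)
    (hw : ∀ n, Function.Bijective ((piGHom P w).app n)) : IsIso w := by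
  obtain ⟨Z, g, δ, hT⟩ := Pretriangulated.distinguished_cocone_triangle w
  refine (Triangle.isZero₃_iff_isIso₁ _ hT).1 (hgen _ fun n (u : P⟦n⟧ ⟶ Z) => ?_)
  have h₃₁ : δ ≫ w⟦(1 : ℤ)⟧' = 0 := comp_distTriang_mor_zero₃₁ _ hT
  have h₁₂ : w ≫ g = 0 := comp_distTriang_mor_zero₁₂ _ hT
  have hn : n + -1 = n - 1 := by omega
  have h1 : (1 : ℤ) + -1 = 0 := by omega
  have hu : u ≫ δ = 0 := by
    apply (unshift_bijective P hn h1).injective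
    rw [unshift_zero]
    apply (hw (n - 1)).injective
    rw [map_zero, piGHom_app, ← unshift_comp, Category.assoc, h₃₁, comp_zero, unshift_zero]
  obtain ⟨v, rfl⟩ := Triangle.coyoneda_exact₃ _ hT u hu
  obtain ⟨v', rfl⟩ := (hw n).surjective v
  exact (Category.assoc _ _ _).trans ((congrArg (v' ≫ ·) h₁₂).trans comp_zero)

end Triangles

section Vanishing

variable [HasCoproducts.{v} C]

/-- If `X` has homotopy in `B[j]`, it admits a cover `Q ⟶ X` with `π_*Q` projective in `B[j]`,
whose fibre `K` also has homotopy in `B[j]`. -/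
theorem IsCompactObj.exists_cover_triangle {P : C} (hP : IsCompactObj P) {N : ℕ}
    (hsp : Sparse P N) {j : ZMod N} {X : C} (hX : InDegrees N j (piMod P X)) :
    ∃ (K Q : C) (k : K ⟶ Q) (p : Q ⟶ X) (d : X ⟶ K⟦(1 : ℤ)⟧),
      Triangle.mk k p d ∈ distTriang C ∧ InDegrees N j (piMod P K) ∧
      IsProjective (piMod P Q) ∧ IsShortExact (piGHom P k) (piGHom P p) ∧
      ∀ Z : C, Function.Bijective fun f : Q ⟶ Z => piGHom P f := by
  obtain ⟨Q, p, hQ, hproj, hp, hbij⟩ := hP.exists_cover hsp hX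
  obtain ⟨K, k, d, hT⟩ := distinguished_cocone_triangle₁ p
  have hse := isShortExact_of_surj_mor₂ P hT hp
  refine ⟨K, Q, k, p, d, hT, fun n hn u => hse.mono n ?_, hproj, hse, hbij⟩
  rw [map_zero]
  exact hQ n hn _

theorem eq_zero_of_isProjective {P : C} (hP : IsCompactObj P) (hgen : IsGenerator P) {N : ℕ}
    (hsp : Sparse P N) {j : ZMod N} {X : C} (hX : InDegrees N j (piMod P X))
    (hproj : IsProjective (piMod P X)) {Z : C} (f : X ⟶ Z) (hf : piGHom P f = 0) : f = 0 := by
  obtain ⟨K, Q, k, p, d, hT, -, -, hse, hbij⟩ := hP.exists_cover_triangle hsp hX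
  obtain ⟨-, r, -, -, hr⟩ := hse.exists_splitting hproj
  obtain ⟨R, hR⟩ := (hbij K).surjective r
  subst hR
  have : IsIso (k ≫ R) := hgen.isIso_of_bijective _ fun n => by
    convert Function.bijective_id
    ext u
    exact (Category.assoc _ _ _).symm.trans (hr n u)
  have : Mono k := mono_of_mono k R
  have hd : d = 0 := Triangle.mor₃_eq_zero_of_mono₁ _ hT this
  have hpf : p ≫ f = 0 := (hbij Z).injective (by
    show piGHom P _ = piGHom P 0
    rw [← piGHom_comp, hf, piGHom_zero]
    rfl)
  obtain ⟨g, hg⟩ : ∃ g : K⟦(1 : ℤ)⟧ ⟶ Z, f = d ≫ g := Triangle.yoneda_exact₃ _ hT f hpf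
  rw [hg, hd, zero_comp]

/-- A map out of `ΣK` vanishes when all maps `K ⟶ Σ⁻¹Z` vanish. -/
theorem eq_zero_of_shift {K Z : C} (g : K⟦(1 : ℤ)⟧ ⟶ Z)
    (h : ∀ f : K ⟶ Z⟦(-1 : ℤ)⟧, f = 0) : g = 0 := by
  apply (shiftFunctor C (-1 : ℤ)).map_injective
  rw [Functor.map_zero,
    ← cancel_epi ((shiftFunctorCompIsoId C (1 : ℤ) (-1) (by omega)).inv.app K), comp_zero]
  exact h _

theorem piGHom_eq_zero_of_inDegrees {P : C} {N : ℕ} {j k : ZMod N} {X Z : C}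
    (hX : InDegrees N j (piMod P X)) (hZ : InDegrees N k (piMod P Z)) (hjk : k ≠ j)
    (f : X ⟶ Z) : piGHom P f = 0 := by
  ext n u
  by_cases hn : (n : ZMod N) = j
  · exact hZ n (fun h => hjk (h.symm.trans hn)) _
  · rw [hX n hn u, map_zero, map_zero]

theorem eq_zero_of_projDimLE {P : C} (hP : IsCompactObj P) (hgen : IsGenerator P) {N : ℕ}
    (hsp : Sparse P N) {j : ZMod N} (d : ℕ) {X : C} (hX : InDegrees N j (piMod P X))
    (hd : projDimLE d (piMod P X)) {k : ZMod N} {Z : C} (hZ : InDegrees N k (piMod P Z))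
    (hk : ∀ e ≤ d, k ≠ j + e) (f : X ⟶ Z) : f = 0 := by
  induction d generalizing X Z k with
  | zero =>
    exact eq_zero_of_isProjective hP hgen hsp hX hd f
      (piGHom_eq_zero_of_inDegrees hX hZ (by simpa using hk 0 le_rfl) f)
  | succ d ih =>
    obtain ⟨K, Q, i, p, δ, hT, hK, hQ, hse, hbij⟩ := hP.exists_cover_triangle hsp hX
    have hpf : p ≫ f = 0 := (hbij Z).injective (by
      show piGHom P _ = piGHom P 0
      rw [← piGHom_comp, piGHom_zero,
        piGHom_eq_zero_of_inDegrees hX hZ (by simpa using hk 0 (by omega)) f]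
      rfl)
    obtain ⟨g, hg⟩ : ∃ g : K⟦(1 : ℤ)⟧ ⟶ Z, f = δ ≫ g := Triangle.yoneda_exact₃ _ hT f hpf
    suffices hg₀ : g = 0 by rw [hg, hg₀, comp_zero]
    refine eq_zero_of_shift g fun u => ?_
    refine ih hK (hd.of_shortExact_projective hse hQ) (hZ.shift (-1) rfl) (fun e he h => ?_) u
    refine hk (e + 1) (by omega) ?_
    push_cast at h ⊢
    linear_combination h

end Vanishing

section FullyFaithful

variable [HasCoproducts.{v} C]

theorem eq_zero_of_piGHom_eq_zero {P : C} (hP : IsCompactObj P) (hgen : IsGenerator P) {N : ℕ}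
    (hN : 2 ≤ N) (hsp : Sparse P N) (hgl : ∀ M : GradedModule P, projDimLE (N - 1) M)
    {j : ZMod N} {X Z : C} (hX : InDegrees N j (piMod P X)) (hZ : InDegrees N j (piMod P Z))
    (f : X ⟶ Z) (hf : piGHom P f = 0) : f = 0 := by
  obtain ⟨K, Q, i, p, δ, hT, hK, hQ, hse, hbij⟩ := hP.exists_cover_triangle hsp hX
  have hpf : p ≫ f = 0 := (hbij Z).injective (by
    show piGHom P _ = piGHom P 0
    rw [← piGHom_comp, piGHom_zero, hf]
    rfl)
  obtain ⟨g, hg⟩ : ∃ g : K⟦(1 : ℤ)⟧ ⟶ Z, f = δ ≫ g := Triangle.yoneda_exact₃ _ hT f hpf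
  suffices hg₀ : g = 0 by rw [hg, hg₀, comp_zero]
  refine eq_zero_of_shift g fun u => ?_
  have hM : projDimLE (N - 2 + 1) (piMod P X) := by
    rw [show N - 2 + 1 = N - 1 by omega]
    exact hgl _
  refine eq_zero_of_projDimLE hP hgen hsp (N - 2) hK (hM.of_shortExact_projective hse hQ)
    (hZ.shift (-1) rfl) (fun e he h => ?_) u
  have h' : ((e + 1 : ℕ) : ZMod N) = 0 := by
    push_cast at h ⊢
    linear_combination -h
  rw [ZMod.natCast_eq_zero_iff] at h'
  have := Nat.le_of_dvd (by omega) h'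
  omega

/-- Under the sparseness and dimension hypotheses, `π_*` is full on the objects whose homotopy
is in `B[j]`. -/
theorem exists_piGHom_eq {P : C} (hP : IsCompactObj P) (hgen : IsGenerator P) {N : ℕ}
    (hN : 2 ≤ N) (hsp : Sparse P N) (hgl : ∀ M : GradedModule P, projDimLE (N - 1) M)
    {j : ZMod N} {X Z : C} (hX : InDegrees N j (piMod P X)) (hZ : InDegrees N j (piMod P Z))
    (φ : GHom (piMod P X) (piMod P Z)) : ∃ f : X ⟶ Z, piGHom P f = φ := by
  obtain ⟨K, Q, i, p, δ, hT, hK, hQ, hse, hbij⟩ := hP.exists_cover_triangle hsp hX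
  obtain ⟨q, hq⟩ := (hbij Z).surjective (φ.comp (piGHom P p))
  have hiq : i ≫ q = 0 := by
    refine eq_zero_of_piGHom_eq_zero hP hgen hN hsp hgl hK hZ _ ?_
    rw [← piGHom_comp]
    ext n u
    refine (GHom.congr_app hq n _).trans ?_
    rw [GHom.comp_app, hse.comp_app, map_zero, GHom.zero_app]
  obtain ⟨f, rfl⟩ := Triangle.yoneda_exact₂ _ hT q hiq
  refine ⟨f, ?_⟩
  ext n u
  obtain ⟨w, rfl⟩ := hse.epi n u
  exact (Category.assoc _ _ _).trans (GHom.congr_app hq n w)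

end FullyFaithful

section ExtensionClass

theorem triangleConnect_comp (P : C) {X V Z : C} (ψ : V ⟶ Z) (δ : Z ⟶ X⟦(1 : ℤ)⟧) :
    (triangleConnect P δ).comp (piGHom P ψ) = triangleConnect P (ψ ≫ δ) := by
  ext n u
  exact congrArg (unshift P _ _) (Category.assoc _ _ _)

theorem piGHom_eq_of_triangleConnect_eq (P : C) {X V : C} {b b' : V ⟶ X⟦(1 : ℤ)⟧}
    (h : triangleConnect P b = triangleConnect P b') : piGHom P b = piGHom P b' := by
  ext n u
  exact (unshift_bijective P _ _).injective (GHom.congr_app h n u)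

/-- A morphism of distinguished triangles which is the identity on `X` and `Y` induces a morphism
of extensions. -/
theorem GExtension.rel_of_distTriang (P : C) {X Y Z Z' : C} {f : X ⟶ Y} {g : Y ⟶ Z}
    {δ : Z ⟶ X⟦(1 : ℤ)⟧} {g' : Y ⟶ Z'} {δ' : Z' ⟶ X⟦(1 : ℤ)⟧}
    (hT : Triangle.mk f g δ ∈ distTriang C) (hT' : Triangle.mk f g' δ' ∈ distTriang C)
    (hse : IsShortExact (piGHom P g) (triangleConnect P δ))
    (hse' : IsShortExact (piGHom P g') (triangleConnect P δ')) :
    GExtension.Rel (B := gshift 1 (piMod P X)) (Z := piMod P Y) ⟨_, _, _, hse⟩ ⟨_, _, _, hse'⟩ := by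
  obtain ⟨φ, h₁, h₂⟩ : ∃ φ : Z ⟶ Z', g ≫ φ = 𝟙 Y ≫ g' ∧ δ ≫ (𝟙 X)⟦(1 : ℤ)⟧' = φ ≫ δ' :=
    complete_distinguished_triangle_morphism _ _ hT hT' (𝟙 X) (𝟙 Y)
      ((Category.comp_id _).trans (Category.id_comp _).symm)
  rw [Category.id_comp] at h₁
  rw [CategoryTheory.Functor.map_id, Category.comp_id] at h₂
  refine ⟨piGHom P φ, ?_, ?_⟩
  · show (piGHom P φ).comp (piGHom P g) = piGHom P g'
    rw [piGHom_comp, h₁]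
  · show (triangleConnect P δ').comp (piGHom P φ) = triangleConnect P δ
    rw [triangleConnect_comp, h₂]

variable [HasCoproducts.{v} C]

/-- If `ΣX` has homotopy in `B[i]`, there is a distinguished triangle `X ⟶ W ⟶ V ⟶ ΣX` with
`π_*V` projective in `B[i]` that is short exact on homotopy. -/
theorem IsCompactObj.exists_cover_shift {P : C} (hP : IsCompactObj P) {N : ℕ} (hsp : Sparse P N)
    {i : ZMod N} {X : C} (hX : InDegrees N i (piMod P (X⟦(1 : ℤ)⟧))) :
    ∃ (W V : C) (d : X ⟶ W) (a : W ⟶ V) (b : V ⟶ X⟦(1 : ℤ)⟧),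
      Triangle.mk d a b ∈ distTriang C ∧ InDegrees N i (piMod P W) ∧
      IsProjective (piMod P V) ∧ IsShortExact (piGHom P a) (triangleConnect P b) ∧
      ∀ Z : C, Function.Bijective fun f : V ⟶ Z => piGHom P f := by
  obtain ⟨V, b, hV, hproj, hb, hbij⟩ := hP.exists_cover hsp hX
  obtain ⟨W, d, a, hT⟩ := distinguished_cocone_triangle₂ b
  have ha := injective_of_surj_mor₃ P hT hb
  refine ⟨W, V, d, a, b, hT, fun n hn u => ha n ?_, hproj,
    isShortExact_of_piGHom_eq_zero P hT fun n u => ha n ?_, hbij⟩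
  · rw [map_zero]
    exact hV n hn _
  · have hda : d ≫ a = 0 := comp_distTriang_mor_zero₁₂ _ hT
    rw [map_zero, piGHom_app, Category.assoc, hda, comp_zero]

/-- A lift of `π_*V → (π_*X)[1]` along an extension coming from a triangle is realised by a
morphism of triangles which is the identity on `X`. -/
theorem exists_hom_of_lift (P : C) {X Y Z W V : C} {d : X ⟶ W} {a : W ⟶ V}
    {b : V ⟶ X⟦(1 : ℤ)⟧} (hT : Triangle.mk d a b ∈ distTriang C)
    (hbij : ∀ Z : C, Function.Bijective fun f : V ⟶ Z => piGHom P f)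
    {f : X ⟶ Y} {g : Y ⟶ Z} {δ : Z ⟶ X⟦(1 : ℤ)⟧} (hT' : Triangle.mk f g δ ∈ distTriang C)
    (φ : GHom (piMod P V) (piMod P Z)) (hφ : (triangleConnect P δ).comp φ = triangleConnect P b) :
    ∃ h : W ⟶ Y, d ≫ h = f ∧ (piGHom P g).comp (piGHom P h) = φ.comp (piGHom P a) := by
  obtain ⟨ψ, rfl⟩ := (hbij Z).surjective φ
  have hψ : ψ ≫ δ = b := (hbij _).injective
    (piGHom_eq_of_triangleConnect_eq P ((triangleConnect_comp P ψ δ).symm.trans hφ))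
  obtain ⟨h, h₁, h₂⟩ : ∃ h : W ⟶ Y, d ≫ h = 𝟙 X ≫ f ∧ a ≫ ψ = h ≫ g :=
    complete_distinguished_triangle_morphism₂ _ _ hT hT' (𝟙 X) ψ (by
      refine (congrArg (b ≫ ·) (CategoryTheory.Functor.map_id _ _)).trans ?_
      exact (Category.comp_id _).trans hψ.symm)
  refine ⟨h, h₁.trans (Category.id_comp _), ?_⟩
  show _ = (piGHom P ψ).comp _
  rw [piGHom_comp, piGHom_comp, h₂]

theorem eq_of_extension_rel {P : C} (hP : IsCompactObj P) (hgen : IsGenerator P) {N : ℕ}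
    (hN : 2 ≤ N) (hsp : Sparse P N) (hgl : ∀ M : GradedModule P, projDimLE (N - 1) M)
    {i : ZMod N} {X Y Z Z' : C} (hX : InDegrees N i (piMod P (X⟦(1 : ℤ)⟧)))
    (hY : InDegrees N i (piMod P Y)) {f f' : X ⟶ Y} {g : Y ⟶ Z} {δ : Z ⟶ X⟦(1 : ℤ)⟧}
    {g' : Y ⟶ Z'} {δ' : Z' ⟶ X⟦(1 : ℤ)⟧}
    (hT : Triangle.mk f g δ ∈ distTriang C) (hT' : Triangle.mk f' g' δ' ∈ distTriang C)
    (hse : IsShortExact (piGHom P g) (triangleConnect P δ))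
    (hse' : IsShortExact (piGHom P g') (triangleConnect P δ'))
    (h : GExtension.Rel (B := gshift 1 (piMod P X)) (Z := piMod P Y)
      ⟨_, _, _, hse⟩ ⟨_, _, _, hse'⟩) : f = f' := by
  obtain ⟨W, V, d, a, b, hW, hWi, hproj, -, hbij⟩ := hP.exists_cover_shift hsp hX
  obtain ⟨θ, hθ₁, hθ₂⟩ := h
  change θ.comp (piGHom P g) = piGHom P g' at hθ₁
  change (triangleConnect P δ').comp θ = triangleConnect P δ at hθ₂
  obtain ⟨φ, hφ⟩ := hproj _ _ _ hse.epi (triangleConnect P b)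
  obtain ⟨h, rfl, hh⟩ := exists_hom_of_lift P hW hbij hT φ hφ
  obtain ⟨h', rfl, hh'⟩ := exists_hom_of_lift P hW hbij hT' (θ.comp φ)
    (Eq.trans (congrArg (GHom.comp · φ) hθ₂) hφ)
  have key : h - h' = 0 := by
    refine eq_zero_of_piGHom_eq_zero hP hgen hN hsp hgl hWi hY _ ?_
    ext n u
    have : u ≫ h = u ≫ h' := by
      refine hse'.mono n ?_
      refine Eq.trans ?_ (GHom.congr_app hh' n u).symm
      refine Eq.trans ?_ (congrArg (θ.app n) (GHom.congr_app hh n u))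
      exact (GHom.congr_app hθ₁ n _).symm
    rw [piGHom_app, Preadditive.comp_sub, this, sub_self, GHom.zero_app]
  rw [sub_eq_zero.1 key]

/-- Every extension of `(π_*X)[1]` by `π_*Y` is realised by a distinguished triangle. -/
theorem exists_extension_rel {P : C} (hP : IsCompactObj P) (hgen : IsGenerator P) {N : ℕ}
    (hN : 2 ≤ N) (hsp : Sparse P N) (hgl : ∀ M : GradedModule P, projDimLE (N - 1) M)
    {i : ZMod N} {X Y : C} (hX : InDegrees N i (piMod P (X⟦(1 : ℤ)⟧)))
    (hY : InDegrees N i (piMod P Y)) (e : GExtension (gshift 1 (piMod P X)) (piMod P Y)) :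
    ∃ f : X ⟶ Y, ∀ (Z : C) (g : Y ⟶ Z) (δ : Z ⟶ X⟦(1 : ℤ)⟧),
      Triangle.mk f g δ ∈ distTriang C →
      ∀ hse : IsShortExact (piGHom P g) (triangleConnect P δ), e.Rel ⟨_, _, _, hse⟩ := by
  obtain ⟨W, V, d, a, b, hW, hWi, hproj, hab, hbij⟩ := hP.exists_cover_shift hsp hX
  obtain ⟨E, ι, ρ, he⟩ := e
  obtain ⟨φ, hφ⟩ := hproj _ _ ρ he.epi (triangleConnect P b)
  have hφ' : ∀ n x, ρ.app n (φ.app n x) = (triangleConnect P b).app n x := GHom.congr_app hφ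
  obtain ⟨φ₁, hφ₁⟩ := exists_lift_of_injective ι he.mono (φ.comp (piGHom P a)) fun n x => by
    rw [← he.exact, GHom.comp_app, hφ', hab.comp_app]
  obtain ⟨h, rfl⟩ := exists_piGHom_eq hP hgen hN hsp hgl hWi hY φ₁
  refine ⟨d ≫ h, fun Z g δ hT hse => ?_⟩
  obtain ⟨ψ, h₁, h₂⟩ : ∃ ψ : V ⟶ Z, a ≫ ψ = h ≫ g ∧ b ≫ (𝟙 X)⟦(1 : ℤ)⟧' = ψ ≫ δ :=
    complete_distinguished_triangle_morphism _ _ hW hT (𝟙 X) h (Category.id_comp _).symm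
  rw [CategoryTheory.Functor.map_id, Category.comp_id] at h₂
  have hψ : ∀ n x, (triangleConnect P δ).app n ((piGHom P ψ).app n x) =
      (triangleConnect P b).app n x := fun n x => by
    rw [h₂, ← triangleConnect_comp, GHom.comp_app]
  let q : GHom (prodMod (piMod P V) (piMod P Y)) E :=
    φ.comp (prodFst _ _) + ι.comp (prodSnd _ _)
  let r : GHom (prodMod (piMod P V) (piMod P Y)) (piMod P Z) :=
    (piGHom P ψ).comp (prodFst _ _) + (piGHom P g).comp (prodSnd _ _)
  have hq : ∀ n x y, q.app n (x, y) = φ.app n x + ι.app n y := fun _ _ _ => rfl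
  have hr : ∀ n x y, r.app n (x, y) = (piGHom P ψ).app n x + (piGHom P g).app n y :=
    fun _ _ _ => rfl
  have hqs : q.Surj := fun n t => by
    obtain ⟨x, hx⟩ := hab.epi n (ρ.app n t)
    obtain ⟨y, hy⟩ := (he.exact n (t - φ.app n x)).1 (by rw [map_sub, hφ', hx, sub_self])
    exact ⟨(x, y), by rw [hq, hy, add_sub_cancel]⟩
  obtain ⟨s, hs⟩ := exists_desc_of_surjective q hqs r (by
    rintro n ⟨x, y⟩ hxy
    rw [hq] at hxy
    have hx : (triangleConnect P b).app n x = 0 := by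
      have := congrArg (ρ.app n) hxy
      rwa [map_add, hφ', he.comp_app, add_zero, map_zero] at this
    obtain ⟨k, rfl⟩ := (hab.exact n x).1 hx
    have hk : (piGHom P h).app n k + y = 0 := by
      refine he.mono n ?_
      rw [map_add, map_zero, ← hxy]
      exact congrArg (· + ι.app n y) (GHom.congr_app hφ₁ n k)
    have hg : (piGHom P ψ).app n ((piGHom P a).app n k) =
        (piGHom P g).app n ((piGHom P h).app n k) :=
      (Category.assoc _ _ _).trans ((congrArg (k ≫ ·) h₁).trans (Category.assoc _ _ _).symm)
    rw [hr, hg, ← map_add, hk, map_zero])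
  have hs' : ∀ n x y, s.app n (φ.app n x + ι.app n y) =
      (piGHom P ψ).app n x + (piGHom P g).app n y := fun n x y => GHom.congr_app hs n (x, y)
  refine ⟨s, ?_, ?_⟩
  · ext n y
    have := hs' n 0 y
    rwa [map_zero, map_zero, zero_add, zero_add] at this
  · ext n t
    obtain ⟨⟨x, y⟩, rfl⟩ := hqs n t
    show (triangleConnect P δ).app n (s.app n _) = ρ.app n _
    rw [hq, hs', map_add, map_add, hψ, hφ', hse.comp_app, he.comp_app]

end ExtensionClass

/-- Let `P` be a compact generator of the triangulated category `C`,
with `Λ` `N`-sparse and `gl dim Λ < N`; fix `i ∈ ℤ/N` and objects `X, Y` with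
`π_* X ∈ B[i-1]`, `π_* Y ∈ B[i]`. For any `f : X ⟶ Y`, completing `f` to a
distinguished triangle `X → Y → Cc → ΣX` and applying `π_*` yields a short exact
sequence `0 → π_* Y → π_* Cc → (π_* X)[1] → 0` of graded `Λ`-modules, and the map
`Hom_T(X, Y) → Ext¹_Λ((π_* X)[1], π_* Y)` sending `f` to the extension class of this
short exact sequence is well defined (independent of the chosen triangle) and
bijective. -/
theorem statement_3 [IsTriangulated C] [HasCoproducts.{v} C]
    (P : C) (hcpt : IsCompactObj P) (hgen : IsGenerator P)
    (N : ℕ) (hN : 2 ≤ N) (hsp : Sparse P N)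
    (hgl : ∀ M : GradedModule P, projDimLE (N - 1) M)
    (i : ZMod N) (X Y : C)
    (hX : InDegrees N (i - 1) (piMod P X)) (hY : InDegrees N i (piMod P Y)) :
    (∀ (f : X ⟶ Y) (Cc : C) (g : Y ⟶ Cc) (δ : Cc ⟶ X⟦(1:ℤ)⟧),
        (Triangle.mk f g δ ∈ distTriang C) →
        IsShortExact (piGHom P g) (triangleConnect P δ)) ∧
    ∃ Φ : (X ⟶ Y) → Ext1 (gshift 1 (piMod P X)) (piMod P Y),
      Function.Bijective Φ ∧
      ∀ (f : X ⟶ Y) (Cc : C) (g : Y ⟶ Cc) (δ : Cc ⟶ X⟦(1:ℤ)⟧)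
        (_ : Triangle.mk f g δ ∈ distTriang C)
        (hse : IsShortExact (piGHom P g) (triangleConnect P δ)),
        Φ f = Quot.mk _ ⟨piMod P Cc, piGHom P g, triangleConnect P δ, hse⟩ := by
  have hexact : ∀ (f : X ⟶ Y) (Cc : C) (g : Y ⟶ Cc) (δ : Cc ⟶ X⟦(1:ℤ)⟧),
      (Triangle.mk f g δ ∈ distTriang C) →
      IsShortExact (piGHom P g) (triangleConnect P δ) := fun f Cc g δ hT => by
    have hi : i ≠ i - 1 := fun h => by
      have h1 : ((1 : ℕ) : ZMod N) = 0 := by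
        push_cast
        linear_combination h
      rw [ZMod.natCast_eq_zero_iff] at h1
      have := Nat.le_of_dvd one_pos h1
      omega
    exact isShortExact_of_piGHom_eq_zero P hT fun n u =>
      GHom.congr_app (piGHom_eq_zero_of_inDegrees hX hY hi f) n u
  have hX₁ : InDegrees N i (piMod P (X⟦(1 : ℤ)⟧)) := hX.shift 1 (by push_cast; ring)
  choose Z g δ hT using fun f : X ⟶ Y => distinguished_cocone_triangle f
  refine ⟨hexact, fun f => Quot.mk _ ⟨_, _, _, hexact f _ _ _ (hT f)⟩, ⟨fun f f' h => ?_, ?_⟩,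
    fun f Cc g' δ' hT' hse => Quot.sound (GExtension.rel_of_distTriang P (hT f) hT' _ hse)⟩
  · exact eq_of_extension_rel hcpt hgen hN hsp hgl hX₁ hY (hT f) (hT f') _ _
      (GExtension.rel_of_mk_eq h)
  · rintro ⟨e⟩
    obtain ⟨f, hf⟩ := exists_extension_rel hcpt hgen hN hsp hgl hX₁ hY e
    exact ⟨f, (Quot.sound (hf _ _ _ (hT f) _)).symm⟩

end Franke
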